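/- Suppose every buyer has a CES substitutes utility (0 < ρ_i ≤ 1) and all buyers repeatedly update their spending by the Proportional Response rule b_ij^{t+1} = e_i · a_ij (b_ij^t/p_j(b^t))^{ρ_i} / Σ_k a_ik (b_ik^t/p_k(b^t))^{ρ_i}, starting from an entrywise positive feasible b^0. Let b* be a minimizer of Φ over the feasible set (the equilibrium spending). Then for all T ≥ 1: Φ(b^T) − Φ(b*) ≤ (1/T) · Σ_i (1/ρ_i)·KL(b_i* ‖ b_i^0). -/

import Mathlib

open Finset

/-- Price of good `j` given spending `b`. -/
noncomputable def price {m n : ℕ} (b : Fin m → Fin n → ℝ) (j : Fin n) : ℝ :=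
  ∑ i, b i j

/-- KL divergence between two nonnegative vectors. -/
noncomputable def KL {n : ℕ} (x y : Fin n → ℝ) : ℝ :=
  ∑ j, x j * Real.log (x j / y j)

/-- Feasible spending: nonnegative entries, each buyer spends exactly her budget. -/
def Feasible {m n : ℕ} (e : Fin m → ℝ) (b : Fin m → Fin n → ℝ) : Prop :=
  ∀ i, (∀ j, 0 ≤ b i j) ∧ ∑ j, b i j = e i

/-- The potential function `Φ` for CES substitutes buyers. -/
noncomputable def Phi {m n : ℕ} (a : Fin m → Fin n → ℝ) (ρ : Fin m → ℝ)
    (b : Fin m → Fin n → ℝ) : ℝ :=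
  -∑ i, (1 / ρ i) * ∑ j, b i j * Real.log (a i j * b i j ^ (ρ i - 1) / price b j ^ ρ i)

/-- One step of the Proportional Response dynamics. -/
noncomputable def propResponse {m n : ℕ} (e : Fin m → ℝ) (a : Fin m → Fin n → ℝ) (ρ : Fin m → ℝ)
    (b : Fin m → Fin n → ℝ) (i : Fin m) (j : Fin n) : ℝ :=
  e i * (a i j * (b i j / price b j) ^ ρ i) / ∑ k, a i k * (b i k / price b k) ^ ρ i

/-- The Bregman divergence `∑ i, KL(x_i ‖ y_i) / ρ_i`. -/
noncomputable def weightedKL {m n : ℕ} (ρ : Fin m → ℝ) (x y : Fin m → Fin n → ℝ) : ℝ :=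
  ∑ i, (1 / ρ i) * KL (x i) (y i)

theorem sub_le_mul_log_div {x y : ℝ} (hx : 0 ≤ x) (hy : 0 < y) : x - y ≤ x * Real.log (x / y) := by
  rcases hx.eq_or_lt with rfl | hx
  · simpa using hy.le
  · have h := mul_le_mul_of_nonneg_left (Real.one_sub_inv_le_log_of_pos (div_pos hx hy)) hx.le
    have h' : x * (1 - (x / y)⁻¹) = x - y := by field_simp
    linarith

theorem KL_nonneg {n : ℕ} {x y : Fin n → ℝ} (hx : ∀ j, 0 ≤ x j) (hy : ∀ j, 0 < y j)
    (hxy : ∑ j, x j = ∑ j, y j) : 0 ≤ KL x y := by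
  have h : ∑ j, (x j - y j) ≤ KL x y := sum_le_sum fun j _ => sub_le_mul_log_div (hx j) (hy j)
  rw [sum_sub_distrib, hxy, sub_self] at h
  exact h

theorem KL_self {n : ℕ} (x : Fin n → ℝ) : KL x x = 0 := by
  refine sum_eq_zero fun j _ => ?_
  by_cases h : x j = 0 <;> simp [h]

theorem price_pos {m n : ℕ} [NeZero m] {b : Fin m → Fin n → ℝ} (hb : ∀ i j, 0 < b i j)
    (j : Fin n) : 0 < price b j :=
  sum_pos (fun i _ => hb i j) univ_nonempty

theorem price_nonneg {m n : ℕ} {x : Fin m → Fin n → ℝ} (hx : ∀ i j, 0 ≤ x i j) (j : Fin n) :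
    0 ≤ price x j :=
  sum_nonneg fun i _ => hx i j

theorem price_pos_of_pos {m n : ℕ} {x : Fin m → Fin n → ℝ} (hx : ∀ i j, 0 ≤ x i j)
    {i : Fin m} {j : Fin n} (hij : 0 < x i j) : 0 < price x j :=
  hij.trans_le (single_le_sum (f := fun i => x i j) (fun i _ => hx i j) (mem_univ i))

theorem Feasible.sum_price {m n : ℕ} {e : Fin m → ℝ} {x : Fin m → Fin n → ℝ}
    (hx : Feasible e x) : ∑ j, price x j = ∑ i, e i := by
  unfold price
  rw [sum_comm]
  exact sum_congr rfl fun i _ => (hx i).2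

theorem KL_price {m n : ℕ} (x b : Fin m → Fin n → ℝ) :
    KL (price x) (price b) = ∑ i, ∑ j, x i j * Real.log (price x j / price b j) := by
  rw [sum_comm]
  refine sum_congr rfl fun j _ => ?_
  rw [← sum_mul]
  rfl

/-- The log-sum inequality, summed over goods. -/
theorem KL_price_le {m n : ℕ} [NeZero m] {x b : Fin m → Fin n → ℝ} (hx : ∀ i j, 0 ≤ x i j)
    (hb : ∀ i j, 0 < b i j) : KL (price x) (price b) ≤ ∑ i, KL (x i) (b i) := by
  have key : ∀ i j, x i j * Real.log (price x j / price b j) + (x i j - b i j * (price x j / price b j))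
      ≤ x i j * Real.log (x i j / b i j) := by
    intro i j
    have hpb := price_pos hb j
    rcases (hx i j).eq_or_lt with h | h
    · rw [← h]
      have := mul_nonneg (hb i j).le (div_nonneg (price_nonneg hx j) hpb.le)
      simpa using this
    · have hpx := price_pos_of_pos hx h
      have h1 := sub_le_mul_log_div h.le (mul_pos (hb i j) (div_pos hpx hpb))
      rw [← div_div, Real.log_div (div_pos h (hb i j)).ne' (div_pos hpx hpb).ne'] at h1
      linarith
  have hzero : ∑ i, ∑ j, (x i j - b i j * (price x j / price b j)) = 0 := by
    rw [sum_comm]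
    refine sum_eq_zero fun j _ => ?_
    rw [sum_sub_distrib, ← sum_mul]
    change price x j - price b j * (price x j / price b j) = 0
    rw [mul_div_cancel₀ _ (price_pos hb j).ne', sub_self]
  have h := sum_le_sum fun i (_ : i ∈ univ) => sum_le_sum fun j (_ : j ∈ univ) => key i j
  simp only [sum_add_distrib] at h
  rw [hzero, add_zero, ← KL_price] at h
  exact h

/-- First-order expansion of `Phi` at a positive point `b`, with its exact remainder. -/
theorem Phi_eq {m n : ℕ} [NeZero m] {a : Fin m → Fin n → ℝ} (ha : ∀ i j, 0 < a i j)
    {ρ : Fin m → ℝ} (hρ : ∀ i, 0 < ρ i) {x b : Fin m → Fin n → ℝ} (hx : ∀ i j, 0 ≤ x i j)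
    (hb : ∀ i j, 0 < b i j) :
    Phi a ρ x =
      -∑ i, (1 / ρ i) * ∑ j, x i j * Real.log (a i j * b i j ^ (ρ i - 1) / price b j ^ ρ i)
      + ∑ i, (1 / ρ i - 1) * KL (x i) (b i) + KL (price x) (price b) := by
  rw [KL_price]
  simp only [Phi, KL, mul_sum, ← sum_neg_distrib, ← sum_add_distrib]
  refine sum_congr rfl fun i _ => sum_congr rfl fun j _ => ?_
  rcases (hx i j).eq_or_lt with h | h
  · simp [← h]
  · have hpx := price_pos_of_pos hx h
    have hpb := price_pos hb j
    have hbi := hb i j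
    have hai := ha i j
    have hρi := hρ i
    have hlog : ∀ y p : ℝ, 0 < y → 0 < p → Real.log (a i j * y ^ (ρ i - 1) / p ^ ρ i) =
        Real.log (a i j) + (ρ i - 1) * Real.log y - ρ i * Real.log p := by
      intro y p hy hp
      rw [Real.log_div (by positivity) (by positivity), Real.log_mul (by positivity) (by positivity),
        Real.log_rpow hy, Real.log_rpow hp]
    rw [hlog _ _ h hpx, hlog _ _ hbi hpb, Real.log_div h.ne' hbi.ne', Real.log_div hpx.ne' hpb.ne']
    field_simp
    ring

section PropResponse

variable {m n : ℕ} {e : Fin m → ℝ} {a : Fin m → Fin n → ℝ} {ρ : Fin m → ℝ} {b : Fin m → Fin n → ℝ}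

theorem sum_share_pos [NeZero m] (ha : ∀ i j, 0 < a i j) (hb : ∀ i j, 0 < b i j) (he : ∀ i, 0 < e i)
    (hbF : Feasible e b) (i : Fin m) : 0 < ∑ k, a i k * (b i k / price b k) ^ ρ i := by
  refine sum_pos (fun k _ => mul_pos (ha i k)
    (Real.rpow_pos_of_pos (div_pos (hb i k) (price_pos hb k)) _)) ?_
  by_contra h
  have := (hbF i).2
  rw [not_nonempty_iff_eq_empty.1 h, sum_empty] at this
  exact (he i).ne this

theorem propResponse_pos [NeZero m] (ha : ∀ i j, 0 < a i j) (hb : ∀ i j, 0 < b i j)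
    (he : ∀ i, 0 < e i) (hbF : Feasible e b) (i : Fin m) (j : Fin n) :
    0 < propResponse e a ρ b i j :=
  div_pos (mul_pos (he i) (mul_pos (ha i j)
    (Real.rpow_pos_of_pos (div_pos (hb i j) (price_pos hb j)) _))) (sum_share_pos ha hb he hbF i)

theorem propResponse_feasible [NeZero m] (ha : ∀ i j, 0 < a i j) (hb : ∀ i j, 0 < b i j)
    (he : ∀ i, 0 < e i) (hbF : Feasible e b) : Feasible e (propResponse e a ρ b) := by
  refine fun i => ⟨fun j => (propResponse_pos ha hb he hbF i j).le, ?_⟩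
  unfold propResponse
  rw [← sum_div, ← mul_sum, mul_div_cancel_right₀ _ (sum_share_pos ha hb he hbF i).ne']

theorem log_marginal_eq [NeZero m] (ha : ∀ i j, 0 < a i j) (hb : ∀ i j, 0 < b i j)
    (he : ∀ i, 0 < e i) (hbF : Feasible e b) (i : Fin m) (j : Fin n) :
    Real.log (a i j * b i j ^ (ρ i - 1) / price b j ^ ρ i) =
      Real.log (propResponse e a ρ b i j) - Real.log (b i j)
        - Real.log (e i / ∑ k, a i k * (b i k / price b k) ^ ρ i) := by
  have hZ := sum_share_pos (ρ := ρ) ha hb he hbF i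
  have hpb := price_pos hb j
  have hbi := hb i j
  have hai := ha i j
  have hei := he i
  unfold propResponse
  rw [Real.log_div (by positivity) hZ.ne', Real.log_div hei.ne' hZ.ne',
    Real.log_mul hei.ne' (by positivity), Real.log_mul hai.ne' (by positivity),
    Real.log_rpow (by positivity), Real.log_div hbi.ne' hpb.ne',
    Real.log_div (by positivity) (by positivity), Real.log_mul (by positivity) (by positivity),
    Real.log_rpow hbi, Real.log_rpow hpb]
  ring

/-- The linearization of `Phi` at `b`, in terms of divergences to `b` and its update. -/
theorem linearization_eq [NeZero m] (ha : ∀ i j, 0 < a i j) (hb : ∀ i j, 0 < b i j)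
    (he : ∀ i, 0 < e i) (hbF : Feasible e b) {x : Fin m → Fin n → ℝ} (hx : Feasible e x) :
    -∑ i, (1 / ρ i) * ∑ j, x i j * Real.log (a i j * b i j ^ (ρ i - 1) / price b j ^ ρ i) =
      ∑ i, (1 / ρ i) * (e i * Real.log (e i / ∑ k, a i k * (b i k / price b k) ^ ρ i))
        - weightedKL ρ x b + weightedKL ρ x (propResponse e a ρ b) := by
  unfold weightedKL
  rw [← sum_sub_distrib, ← sum_add_distrib, ← sum_neg_distrib]
  refine sum_congr rfl fun i _ => ?_
  rw [← mul_sub, ← mul_add, ← mul_neg]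
  congr 1
  conv_rhs => enter [1, 1, 1]; rw [← (hx i).2]
  rw [sum_mul, KL, KL, ← sum_sub_distrib, ← sum_add_distrib, ← sum_neg_distrib]
  refine sum_congr rfl fun j _ => ?_
  rcases ((hx i).1 j).eq_or_lt with h | h
  · simp [← h]
  · rw [log_marginal_eq ha hb he hbF, Real.log_div h.ne' (hb i j).ne',
      Real.log_div h.ne' (propResponse_pos ha hb he hbF i j).ne']
    ring

/-- The mirror-descent inequality for one Proportional Response step. -/
theorem Phi_propResponse_le [NeZero m] (ha : ∀ i j, 0 < a i j) (hρ : ∀ i, 0 < ρ i ∧ ρ i ≤ 1)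
    (hb : ∀ i j, 0 < b i j) (he : ∀ i, 0 < e i) (hbF : Feasible e b) {x : Fin m → Fin n → ℝ}
    (hx : Feasible e x) :
    Phi a ρ (propResponse e a ρ b) + weightedKL ρ x (propResponse e a ρ b) ≤
      Phi a ρ x + weightedKL ρ x b := by
  have hc : Feasible e (propResponse e a ρ b) := propResponse_feasible ha hb he hbF
  have hupper := Phi_eq ha (fun i => (hρ i).1) (fun i j => (hc i).1 j) hb
  have hlower := Phi_eq ha (fun i => (hρ i).1) (fun i j => (hx i).1 j) hb
  rw [linearization_eq ha hb he hbF hc] at hupper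
  rw [linearization_eq ha hb he hbF hx] at hlower
  have hself : weightedKL ρ (propResponse e a ρ b) (propResponse e a ρ b) = 0 := by
    simp [weightedKL, KL_self]
  have hsplit : ∑ i, (1 / ρ i - 1) * KL (propResponse e a ρ b i) (b i) =
      weightedKL ρ (propResponse e a ρ b) b - ∑ i, KL (propResponse e a ρ b i) (b i) := by
    simp [weightedKL, sub_mul]
  have hprice := KL_price_le (fun i j => (hc i).1 j) hb
  have hx_price : 0 ≤ KL (price x) (price b) :=
    KL_nonneg (price_nonneg fun i j => (hx i).1 j) (price_pos hb)
      (hx.sum_price.trans hbF.sum_price.symm)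
  have hx_rem : 0 ≤ ∑ i, (1 / ρ i - 1) * KL (x i) (b i) :=
    sum_nonneg fun i _ => mul_nonneg (sub_nonneg.2 (one_le_one_div (hρ i).1 (hρ i).2))
      (KL_nonneg (hx i).1 (hb i) ((hx i).2.trans (hbF i).2.symm))
  linarith

end PropResponse

theorem weightedKL_nonneg {m n : ℕ} {e ρ : Fin m → ℝ} (hρ : ∀ i, 0 < ρ i)
    {x b : Fin m → Fin n → ℝ} (hx : Feasible e x) (hb : ∀ i j, 0 < b i j) (hbF : Feasible e b) :
    0 ≤ weightedKL ρ x b :=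
  sum_nonneg fun i _ => mul_nonneg (one_div_pos.2 (hρ i)).le
    (KL_nonneg (hx i).1 (hb i) ((hx i).2.trans (hbF i).2.symm))

/-- `O(1/T)` convergence of Proportional Response in the CES
substitutes domain `0 < ρ_i ≤ 1`. -/
theorem proportional_response_substitutes_sublinear {m n : ℕ}
    (e : Fin m → ℝ) (he : ∀ i, 0 < e i)
    (a : Fin m → Fin n → ℝ) (ha : ∀ i j, 0 < a i j)
    (ρ : Fin m → ℝ) (hρ : ∀ i, 0 < ρ i ∧ ρ i ≤ 1)
    (b : ℕ → Fin m → Fin n → ℝ)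
    (hb0pos : ∀ i j, 0 < b 0 i j) (hb0 : Feasible e (b 0))
    -- the Proportional Response update
    (hupd : ∀ t i j, b (t + 1) i j =
      e i * (a i j * (b t i j / price (b t) j) ^ ρ i) /
        ∑ k, a i k * (b t i k / price (b t) k) ^ ρ i)
    -- b* minimizes Φ over the feasible set (equilibrium spending)
    (bstar : Fin m → Fin n → ℝ) (hbstarFeas : Feasible e bstar)
    (hbstarMin : ∀ b', Feasible e b' → Phi a ρ bstar ≤ Phi a ρ b')
    (T : ℕ) (hT : 1 ≤ T) :
    Phi a ρ (b T) - Phi a ρ bstar ≤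
      (1 / (T : ℝ)) * ∑ i, (1 / ρ i) * KL (bstar i) (b 0 i) := by
  rcases Nat.eq_zero_or_pos m with rfl | hm
  · simp [Phi]
  have : NeZero m := ⟨hm.ne'⟩
  have hstep : ∀ t, b (t + 1) = propResponse e a ρ (b t) := fun t =>
    funext fun i => funext fun j => hupd t i j
  have hb : ∀ t, (∀ i j, 0 < b t i j) ∧ Feasible e (b t) := by
    intro t
    induction t with
    | zero => exact ⟨hb0pos, hb0⟩
    | succ t ih =>
      rw [hstep]
      exact ⟨propResponse_pos ha ih.1 he ih.2, propResponse_feasible ha ih.1 he ih.2⟩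
  have hdescent : ∀ t x, Feasible e x → Phi a ρ (b (t + 1)) + weightedKL ρ x (b (t + 1)) ≤
      Phi a ρ x + weightedKL ρ x (b t) := fun t x hx => by
    rw [hstep]
    exact Phi_propResponse_le ha hρ (hb t).1 he (hb t).2 hx
  have hKL : ∀ t x, Feasible e x → 0 ≤ weightedKL ρ x (b t) := fun t x hx =>
    weightedKL_nonneg (fun i => (hρ i).1) hx (hb t).1 (hb t).2
  have hmono : ∀ t, Phi a ρ (b (t + 1)) ≤ Phi a ρ (b t) := by
    intro t
    have h := hdescent t (b t) (hb t).2
    have hself : weightedKL ρ (b t) (b t) = 0 := by simp [weightedKL, KL_self]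
    have := hKL (t + 1) (b t) (hb t).2
    linarith
  have hsum : ∀ t : ℕ, t * (Phi a ρ (b t) - Phi a ρ bstar) + weightedKL ρ bstar (b t) ≤
      weightedKL ρ bstar (b 0) := by
    intro t
    induction t with
    | zero => simp
    | succ t ih =>
      have h1 := hdescent t bstar hbstarFeas
      have h2 := mul_le_mul_of_nonneg_left (hmono t) (Nat.cast_nonneg (α := ℝ) t)
      push_cast
      linarith
  have hTpos : (0 : ℝ) < T := by exact_mod_cast hT
  change _ ≤ 1 / (T : ℝ) * weightedKL ρ bstar (b 0)
  rw [one_div_mul_eq_div, le_div_iff₀ hTpos]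
  linarith [hsum T, hKL T bstar hbstarFeas]
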